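/- arXiv:2307.10042 — 4 statements merged into one kernel-verified Lean document; each statement's English description precedes it below -/
import Mathlib

section
/- (Strong duality for R_ρ^ρ.) Let ρ > 1 with Hölder conjugate s, let μ be a distribution with weights μ_i > 0 on points x_1,…,x_n ∈ ℝ^d and ν a distribution with weights ν_j > 0 on points y_1,…,y_m ∈ ℝ^d, with {x_1,…,x_n} and {y_1,…,y_m} disjoint. Then R_ρ(μ, ν)^ρ = sup over all α ∈ ℝ^n and β ∈ ℝ^m of g(α, β), and the supremum is attained. -/
open Finset

noncomputable section

/-- A coupling of two discrete distributions given by weight vectors. -/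
def IsCoupling {n m : ℕ} (μ : Fin n → ℝ) (ν : Fin m → ℝ) (γ : Fin n → Fin m → ℝ) : Prop :=
  (∀ i j, 0 ≤ γ i j) ∧ (∀ i, ∑ j, γ i j = μ i) ∧ (∀ j, ∑ i, γ i j = ν j)

/-- The constant `C_s = (1/s)(1 − 1/s)^{s−1}`. -/
def Cs (s : ℝ) : ℝ := (1 / s) * (1 - 1 / s) ^ (s - 1)

/-- The dual objective `g(α, β)` for `R_ρ(μ, ν)^ρ`, with `s` the Hölder conjugate of `ρ`. -/
def dualObj {d n m : ℕ} (x : Fin n → EuclideanSpace ℝ (Fin d))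
    (y : Fin m → EuclideanSpace ℝ (Fin d)) (μ : Fin n → ℝ) (ν : Fin m → ℝ) (s : ℝ)
    (α : Fin n → ℝ) (β : Fin m → ℝ) : ℝ :=
  ∑ i, μ i * α i - ∑ j, ν j * β j -
    Cs s * ∑ i, ∑ j, μ i * ν j * (max (α i - β j) 0 / ‖x i - y j‖) ^ s


/-- The ℓ_ρ-transport cost of a coupling γ. -/
def transportCost {d n m : ℕ} (x : Fin n → EuclideanSpace ℝ (Fin d))
    (y : Fin m → EuclideanSpace ℝ (Fin d)) (μ : Fin n → ℝ) (ν : Fin m → ℝ) (ρ : ℝ)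
    (γ : Fin n → Fin m → ℝ) : ℝ :=
  (∑ i, ∑ j, μ i * ν j * ((γ i j / (μ i * ν j)) * ‖x i - y j‖) ^ ρ) ^ (1 / ρ)

/-- The ℓ_ρ-optimal-transport cost `R_ρ(μ, ν)`. -/
def Rrho {d n m : ℕ} (x : Fin n → EuclideanSpace ℝ (Fin d))
    (y : Fin m → EuclideanSpace ℝ (Fin d)) (μ : Fin n → ℝ) (ν : Fin m → ℝ) (ρ : ℝ) : ℝ :=
  sInf {c | ∃ γ, IsCoupling μ ν γ ∧ c = transportCost x y μ ν ρ γ}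

lemma Cs_eq_of_holderConjugate {ρ s : ℝ} (h : ρ.HolderConjugate s) :
    Cs s = (1 / s) * (1 / ρ) ^ (s - 1) := by
  have := h.inv_add_inv_eq_one
  rw [Cs]
  congr 2
  simp only [one_div]
  linarith

/-- Young's inequality with the constant `Cs`. -/
lemma mul_le_rpow_add_Cs_mul_rpow {ρ s : ℝ} (h : ρ.HolderConjugate s) {u c : ℝ}
    (hu : 0 ≤ u) (hc : 0 ≤ c) : u * c ≤ u ^ ρ + Cs s * c ^ s := by
  have hρ := h.pos
  have hρ' : (0 : ℝ) < ρ ^ (1 / ρ) := by positivity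
  have key := Real.young_inequality_of_nonneg (a := ρ ^ (1 / ρ) * u) (b := c / ρ ^ (1 / ρ))
    (by positivity) (by positivity) h
  have hmul : ρ ^ (1 / ρ) * u * (c / ρ ^ (1 / ρ)) = u * c := by field_simp
  have hleft : (ρ ^ (1 / ρ) * u) ^ ρ / ρ = u ^ ρ := by
    rw [Real.mul_rpow hρ'.le hu, ← Real.rpow_mul hρ.le, one_div_mul_cancel hρ.ne', Real.rpow_one]
    field_simp
  have hexp : 1 / ρ * s = s - 1 := by
    have := h.symm.sub_one_mul_conj
    field_simp
    linarith
  have hright : (c / ρ ^ (1 / ρ)) ^ s / s = Cs s * c ^ s := by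
    rw [Real.div_rpow hc hρ'.le, ← Real.rpow_mul hρ.le, hexp, Cs_eq_of_holderConjugate h,
      Real.div_rpow zero_le_one hρ.le, Real.one_rpow]
    ring
  rwa [hmul, hleft, hright] at key

/-- The equality case of `mul_le_rpow_add_Cs_mul_rpow`. -/
lemma mul_eq_rpow_add_Cs_mul_rpow {ρ s : ℝ} (h : ρ.HolderConjugate s) {c : ℝ} (hc : 0 ≤ c) :
    (Cs s * s * c ^ (s - 1)) * c = (Cs s * s * c ^ (s - 1)) ^ ρ + Cs s * c ^ s := by
  have hρ := h.pos
  have hs := h.symm.pos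
  have hexp : (s - 1) * ρ = s := h.symm.sub_one_mul_conj
  have hCs : Cs s * s = (1 / ρ) ^ (s - 1) := by
    rw [Cs_eq_of_holderConjugate h]
    field_simp
  have hinv : (0 : ℝ) < 1 / ρ := by positivity
  have hpow {b : ℝ} (hb : 0 ≤ b) : b ^ (s - 1) * b = b ^ s := by
    conv_lhs => rw [← Real.rpow_one b, ← Real.rpow_mul hb, one_mul]
    rw [← Real.rpow_add_of_nonneg hb (by linarith [h.symm.lt]) zero_le_one]
    congr 1
    ring
  rw [hCs, Real.mul_rpow (by positivity) (by positivity), ← Real.rpow_mul hinv.le,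
    ← Real.rpow_mul hc, hexp, mul_assoc, hpow hc, Cs_eq_of_holderConjugate h, ← hpow hinv.le]
  have := h.inv_add_inv_eq_one
  simp only [one_div]
  linear_combination (-(ρ⁻¹ ^ (s - 1) * c ^ s)) * this

lemma hasDerivAt_max_zero_rpow {s : ℝ} (hs : 1 < s) (z : ℝ) :
    HasDerivAt (fun z : ℝ => max z 0 ^ s) (s * max z 0 ^ (s - 1)) z := by
  rcases lt_trichotomy z 0 with hz | rfl | hz
  · have hd : HasDerivAt (fun _ : ℝ => (0 : ℝ)) 0 z := hasDerivAt_const _ _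
    rw [max_eq_right hz.le, Real.zero_rpow (by linarith), mul_zero]
    refine hd.congr_of_eventuallyEq ?_
    filter_upwards [Iio_mem_nhds hz] with w hw
    rw [max_eq_right (le_of_lt hw), Real.zero_rpow (by linarith)]
  · have hd := hasDerivAt_abs_rpow (0 : ℝ) hs
    rw [hasDerivAt_iff_isLittleO] at hd ⊢
    simp only [abs_zero, Real.zero_rpow (show s ≠ 0 by linarith), sub_zero, mul_zero, smul_zero,
      max_self, Real.zero_rpow (show s - 1 ≠ 0 by linarith)] at hd ⊢
    refine (Asymptotics.IsBigO.of_norm_le fun w => ?_).trans_isLittleO hd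
    rw [Real.norm_eq_abs, abs_of_nonneg (by positivity)]
    exact Real.rpow_le_rpow (le_max_right _ _) (max_le (le_abs_self w) (abs_nonneg w))
      (by linarith)
  · rw [max_eq_left hz.le]
    refine (Real.hasDerivAt_rpow_const (Or.inl hz.ne')).congr_of_eventuallyEq ?_
    filter_upwards [Ioi_mem_nhds hz] with w hw
    rw [max_eq_left (le_of_lt hw)]

section Duality

variable {d n m : ℕ} (x : Fin n → EuclideanSpace ℝ (Fin d)) (y : Fin m → EuclideanSpace ℝ (Fin d))
  {μ : Fin n → ℝ} {ν : Fin m → ℝ} {ρ s : ℝ}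

/-- The weights attached to `(α, β)` by the first-order condition for the dual objective. -/
def dualCoupling (μ : Fin n → ℝ) (ν : Fin m → ℝ) (s : ℝ) (α : Fin n → ℝ) (β : Fin m → ℝ)
    (i : Fin n) (j : Fin m) : ℝ :=
  μ i * ν j / ‖x i - y j‖ * (Cs s * s * (max (α i - β j) 0 / ‖x i - y j‖) ^ (s - 1))

lemma sum_sub_sum_eq_of_marginals {a : Fin n → ℝ} {b : Fin m → ℝ} {γ : Fin n → Fin m → ℝ}
    (h₁ : ∀ i, ∑ j, γ i j = μ i) (h₂ : ∀ j, ∑ i, γ i j = ν j) :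
    ∑ i, μ i * a i - ∑ j, ν j * b j = ∑ i, ∑ j, γ i j * (a i - b j) := by
  simp only [mul_sub, sum_sub_distrib, ← h₁, ← h₂, sum_mul]
  congr 1
  exact sum_comm

lemma dualObj_le_of_isCoupling (h : ρ.HolderConjugate s) (hμ0 : ∀ i, 0 < μ i)
    (hν0 : ∀ j, 0 < ν j) (hdisj : ∀ i j, x i ≠ y j) {γ : Fin n → Fin m → ℝ}
    (hγ : IsCoupling μ ν γ) (α : Fin n → ℝ) (β : Fin m → ℝ) :
    dualObj x y μ ν s α β ≤
      ∑ i, ∑ j, μ i * ν j * ((γ i j / (μ i * ν j)) * ‖x i - y j‖) ^ ρ := by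
  obtain ⟨h₀, h₁, h₂⟩ := hγ
  rw [dualObj, sum_sub_sum_eq_of_marginals h₁ h₂]
  simp only [mul_sum]
  simp only [← sum_sub_distrib]
  refine sum_le_sum fun i _ => sum_le_sum fun j _ => ?_
  have hw : 0 < μ i * ν j := mul_pos (hμ0 i) (hν0 j)
  have hd : 0 < ‖x i - y j‖ := norm_pos_iff.2 (sub_ne_zero.2 (hdisj i j))
  have hg := h₀ i j
  have key := mul_le_mul_of_nonneg_left (mul_le_rpow_add_Cs_mul_rpow h
    (u := γ i j / (μ i * ν j) * ‖x i - y j‖) (c := max (α i - β j) 0 / ‖x i - y j‖)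
    (by positivity) (by positivity)) hw.le
  have hmul : μ i * ν j * (γ i j / (μ i * ν j) * ‖x i - y j‖ *
      (max (α i - β j) 0 / ‖x i - y j‖)) = γ i j * max (α i - β j) 0 := by
    have := (hμ0 i).ne'
    have := (hν0 j).ne'
    field_simp
  have hmax := mul_le_mul_of_nonneg_left (le_max_left (α i - β j) 0) hg
  linarith

lemma dualObj_eq_of_isCoupling_dualCoupling (h : ρ.HolderConjugate s) (hμ0 : ∀ i, 0 < μ i)
    (hν0 : ∀ j, 0 < ν j) (hdisj : ∀ i j, x i ≠ y j) {α : Fin n → ℝ} {β : Fin m → ℝ}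
    (hγ : IsCoupling μ ν (dualCoupling x y μ ν s α β)) :
    dualObj x y μ ν s α β = ∑ i, ∑ j, μ i * ν j *
      ((dualCoupling x y μ ν s α β i j / (μ i * ν j)) * ‖x i - y j‖) ^ ρ := by
  rw [dualObj, sum_sub_sum_eq_of_marginals hγ.2.1 hγ.2.2]
  simp only [mul_sum]
  simp only [← sum_sub_distrib]
  refine sum_congr rfl fun i _ => sum_congr rfl fun j _ => ?_
  have hw : 0 < μ i * ν j := mul_pos (hμ0 i) (hν0 j)
  have hd : 0 < ‖x i - y j‖ := norm_pos_iff.2 (sub_ne_zero.2 (hdisj i j))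
  have key := mul_eq_rpow_add_Cs_mul_rpow h (c := max (α i - β j) 0 / ‖x i - y j‖) (by positivity)
  have hu : dualCoupling x y μ ν s α β i j / (μ i * ν j) * ‖x i - y j‖ =
      Cs s * s * (max (α i - β j) 0 / ‖x i - y j‖) ^ (s - 1) := by
    have := (hμ0 i).ne'
    have := (hν0 j).ne'
    rw [dualCoupling]
    field_simp
  have hslack : dualCoupling x y μ ν s α β i j * (α i - β j) = μ i * ν j *
      (Cs s * s * (max (α i - β j) 0 / ‖x i - y j‖) ^ (s - 1) *
        (max (α i - β j) 0 / ‖x i - y j‖)) := by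
    rw [dualCoupling]
    rcases le_total (α i - β j) 0 with hz | hz
    · simp [max_eq_right hz, Real.zero_rpow (sub_ne_zero.2 h.symm.lt.ne')]
    · rw [max_eq_left hz]
      ring
  rw [hu, hslack, key]
  ring

lemma hasDerivAt_dualObj (hs : 1 < s) (α a : Fin n → ℝ) (β b : Fin m → ℝ) :
    HasDerivAt (fun t : ℝ => dualObj x y μ ν s (α + t • a) (β + t • b))
      (∑ i, μ i * a i - ∑ j, ν j * b j -
        ∑ i, ∑ j, dualCoupling x y μ ν s α β i j * (a i - b j)) 0 := by
  have hlin (p q : ℝ) : HasDerivAt (fun t : ℝ => p + t * q) q 0 := by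
    simpa using ((hasDerivAt_id (0 : ℝ)).mul_const q).const_add p
  have hpow (i : Fin n) (j : Fin m) : HasDerivAt
      (fun t : ℝ => Cs s * (μ i * ν j *
        (max ((α i + t * a i) - (β j + t * b j)) 0 / ‖x i - y j‖) ^ s))
      (dualCoupling x y μ ν s α β i j * (a i - b j)) 0 := by
    have hmax := hasDerivAt_max_zero_rpow hs (α i + 0 * a i - (β j + 0 * b j))
    have := ((hmax.comp (0 : ℝ) ((hlin (α i) (a i)).sub (hlin (β j) (b j)))).const_mul
      (Cs s * (μ i * ν j) * (‖x i - y j‖ ^ s)⁻¹))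
    refine (this.congr_deriv ?_).congr_of_eventuallyEq (.of_forall fun t => ?_)
    · rw [dualCoupling, Real.div_rpow (le_max_right _ _) (norm_nonneg _)]
      rcases (norm_nonneg (x i - y j)).eq_or_lt with hd | hd
      · simp [← hd, Real.zero_rpow (show s ≠ 0 by linarith)]
      · rw [Real.rpow_sub_one hd.ne']
        simp only [zero_mul, add_zero]
        field_simp
    · simp only [Function.comp_apply, Pi.sub_apply]
      rw [Real.div_rpow (le_max_right _ _) (norm_nonneg _)]
      ring
  simp only [dualObj, mul_sum, Pi.add_apply, Pi.smul_apply, smul_eq_mul]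
  exact ((HasDerivAt.fun_sum fun i _ => (hlin (α i) (a i)).const_mul (μ i)).sub
    (HasDerivAt.fun_sum fun j _ => (hlin (β j) (b j)).const_mul (ν j))).sub
    (HasDerivAt.fun_sum fun i _ => HasDerivAt.fun_sum fun j _ => hpow i j)

lemma isCoupling_dualCoupling_of_isMax (h : ρ.HolderConjugate s) (hμ0 : ∀ i, 0 < μ i)
    (hν0 : ∀ j, 0 < ν j) {α : Fin n → ℝ} {β : Fin m → ℝ}
    (hmax : ∀ α' β', dualObj x y μ ν s α' β' ≤ dualObj x y μ ν s α β) :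
    IsCoupling μ ν (dualCoupling x y μ ν s α β) := by
  have hcrit (a : Fin n → ℝ) (b : Fin m → ℝ) : ∑ i, μ i * a i - ∑ j, ν j * b j -
      ∑ i, ∑ j, dualCoupling x y μ ν s α β i j * (a i - b j) = 0 := by
    refine IsLocalMax.hasDerivAt_eq_zero (.of_forall fun t => ?_)
      (hasDerivAt_dualObj x y h.symm.lt α a β b)
    simpa using hmax _ _
  refine ⟨fun i j => ?_, fun i => ?_, fun j => ?_⟩
  · have hμ := hμ0 i
    have hν := hν0 j
    have hs := h.symm.pos
    have hρ := h.pos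
    rw [dualCoupling, Cs_eq_of_holderConjugate h]
    positivity
  · have := hcrit (Pi.single i 1) 0
    simp [Pi.single_apply] at this
    linarith
  · have := hcrit 0 (Pi.single j 1)
    simp [Pi.single_apply] at this
    linarith

lemma dualObj_add_const (hμν : ∑ i, μ i = ∑ j, ν j) (α : Fin n → ℝ) (β : Fin m → ℝ) (c : ℝ) :
    dualObj x y μ ν s (fun i => α i + c) (fun j => β j + c) = dualObj x y μ ν s α β := by
  simp only [dualObj, add_sub_add_right_eq_sub, mul_add, sum_add_distrib, ← sum_mul, hμν]

lemma dualObj_add_sum_abs_le (h : ρ.HolderConjugate s) (hμ0 : ∀ i, 0 < μ i)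
    (hν0 : ∀ j, 0 < ν j) (hμ1 : ∑ i, μ i = 1) (hν1 : ∑ j, ν j = 1)
    (hdisj : ∀ i j, x i ≠ y j) (α : Fin n → ℝ) (β : Fin m → ℝ) :
    dualObj x y μ ν s α β + ∑ i, ∑ j, μ i * ν j * |α i - β j| ≤
      ∑ i, ∑ j, μ i * ν j * (2 * ‖x i - y j‖) ^ ρ := by
  rw [dualObj, sum_sub_sum_eq_of_marginals (γ := fun i j => μ i * ν j)
    (fun i => by rw [← mul_sum, hν1, mul_one]) (fun j => by rw [← sum_mul, hμ1, one_mul])]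
  simp only [mul_sum]
  simp only [← sum_sub_distrib, ← sum_add_distrib]
  refine sum_le_sum fun i _ => sum_le_sum fun j _ => ?_
  have hw : 0 < μ i * ν j := mul_pos (hμ0 i) (hν0 j)
  have hd : 0 < ‖x i - y j‖ := norm_pos_iff.2 (sub_ne_zero.2 (hdisj i j))
  have key := mul_le_mul_of_nonneg_left (mul_le_rpow_add_Cs_mul_rpow h
    (u := 2 * ‖x i - y j‖) (c := max (α i - β j) 0 / ‖x i - y j‖)
    (by positivity) (by positivity)) hw.le
  have hmul : 2 * ‖x i - y j‖ * (max (α i - β j) 0 / ‖x i - y j‖) =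
      (α i - β j) + |α i - β j| := by
    rcases le_total (α i - β j) 0 with hz | hz
    · simp [max_eq_right hz, abs_of_nonpos hz]
    · rw [max_eq_left hz, abs_of_nonneg hz]
      field_simp
      ring
  rw [hmul] at key
  linarith

lemma continuous_dualObj (hs : 0 < s) :
    Continuous fun p : (Fin n → ℝ) × (Fin m → ℝ) => dualObj x y μ ν s p.1 p.2 := by
  unfold dualObj
  have (i : Fin n) (j : Fin m) : Continuous fun p : (Fin n → ℝ) × (Fin m → ℝ) =>
      (max (p.1 i - p.2 j) 0 / ‖x i - y j‖) ^ s :=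
    Continuous.rpow_const (by fun_prop) fun _ => Or.inr hs.le
  fun_prop

lemma exists_dualObj_isMax (h : ρ.HolderConjugate s) (hμ0 : ∀ i, 0 < μ i)
    (hν0 : ∀ j, 0 < ν j) (hμ1 : ∑ i, μ i = 1) (hν1 : ∑ j, ν j = 1)
    (hdisj : ∀ i j, x i ≠ y j) :
    ∃ (α : Fin n → ℝ) (β : Fin m → ℝ),
      ∀ α' β', dualObj x y μ ν s α' β' ≤ dualObj x y μ ν s α β := by
  have : Nonempty (Fin n) := by
    by_contra hn
    simp [not_nonempty_iff.1 hn] at hμ1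
  have : Nonempty (Fin m) := by
    by_contra hm
    simp [not_nonempty_iff.1 hm] at hν1
  obtain ⟨i₀⟩ := ‹Nonempty (Fin n)›
  obtain ⟨j₀⟩ := ‹Nonempty (Fin m)›
  set K := ∑ i, ∑ j, μ i * ν j * (2 * ‖x i - y j‖) ^ ρ with hK
  set R := ∑ i, ∑ j, K / (μ i * ν j) with hR
  have hw (i : Fin n) (j : Fin m) : 0 < μ i * ν j := mul_pos (hμ0 i) (hν0 j)
  have hK0 : 0 ≤ K := sum_nonneg fun i _ => sum_nonneg fun j _ => by
    have := hw i j
    positivity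
  have hterm (i : Fin n) (j : Fin m) : 0 ≤ K / (μ i * ν j) := div_nonneg hK0 (hw i j).le
  have hR0 : 0 ≤ R := sum_nonneg fun i _ => sum_nonneg fun j _ => hterm i j
  have hbound {α : Fin n → ℝ} {β : Fin m → ℝ} (hg : 0 ≤ dualObj x y μ ν s α β) (i : Fin n)
      (j : Fin m) : |α i - β j| ≤ R := by
    have hle := dualObj_add_sum_abs_le x y h hμ0 hν0 hμ1 hν1 hdisj α β
    have hnn (i : Fin n) (j : Fin m) : 0 ≤ μ i * ν j * |α i - β j| :=
      mul_nonneg (hw i j).le (abs_nonneg _)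
    have hsingle {f : Fin n → Fin m → ℝ} (hf : ∀ i j, 0 ≤ f i j) : f i j ≤ ∑ i, ∑ j, f i j :=
      (single_le_sum (fun j _ => hf i j) (mem_univ j)).trans
        (single_le_sum (f := fun i => ∑ j, f i j) (fun i _ => sum_nonneg fun j _ => hf i j)
          (mem_univ i))
    refine le_trans ?_ (hsingle hterm)
    rw [le_div_iff₀ (hw i j), mul_comm]
    linarith [hsingle hnn]
  have hzero : dualObj x y μ ν s 0 0 = 0 := by
    simp [dualObj, Real.zero_rpow h.symm.pos.ne']
  obtain ⟨p, -, hp⟩ := (isCompact_closedBall (0 : (Fin n → ℝ) × (Fin m → ℝ)) (2 * R)).exists_isMaxOn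
    ⟨0, by simpa using hR0⟩ (continuous_dualObj x y (μ := μ) (ν := ν) h.symm.pos).continuousOn
  refine ⟨p.1, p.2, fun α β => ?_⟩
  rcases lt_or_ge (dualObj x y μ ν s α β) 0 with hg | hg
  · have := hp (show (0 : (Fin n → ℝ) × (Fin m → ℝ)) ∈ _ by simpa using hR0)
    exact (hg.trans_eq hzero.symm).le.trans this
  · rw [← dualObj_add_const x y (hμ1.trans hν1.symm) α β (-α i₀)]
    refine hp (show ((fun i => α i + -α i₀, fun j => β j + -α i₀) :
      (Fin n → ℝ) × (Fin m → ℝ)) ∈ _ from ?_)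
    rw [mem_closedBall_zero_iff, norm_prod_le_iff, pi_norm_le_iff_of_nonneg (by linarith),
      pi_norm_le_iff_of_nonneg (by linarith)]
    refine ⟨fun i => ?_, fun j => ?_⟩
    · have h₁ := abs_le.1 (hbound hg i j₀)
      have h₂ := abs_le.1 (hbound hg i₀ j₀)
      exact abs_le.2 ⟨by linarith, by linarith⟩
    · have h₂ := abs_le.1 (hbound hg i₀ j)
      exact abs_le.2 ⟨by linarith, by linarith⟩

end Duality

/-- strong duality for `R_ρ^ρ`: `R_ρ(μ,ν)^ρ` is the attained supremum of the
dual objective `g(α, β)` over all `α ∈ ℝ^n`, `β ∈ ℝ^m`. -/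
theorem strong_duality {d n m : ℕ} (x : Fin n → EuclideanSpace ℝ (Fin d))
    (y : Fin m → EuclideanSpace ℝ (Fin d)) (ρ s : ℝ) (hρ : 1 < ρ) (hs : 1 < s)
    (hconj : 1 / ρ + 1 / s = 1)
    (μ : Fin n → ℝ) (ν : Fin m → ℝ)
    (hμ0 : ∀ i, 0 < μ i) (hν0 : ∀ j, 0 < ν j)
    (hμ1 : ∑ i, μ i = 1) (hν1 : ∑ j, ν j = 1)
    (hdisj : ∀ i j, x i ≠ y j) :
    IsGreatest {v : ℝ | ∃ (α : Fin n → ℝ) (β : Fin m → ℝ), v = dualObj x y μ ν s α β}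
      (Rrho x y μ ν ρ ^ ρ) := by
  have h : ρ.HolderConjugate s :=
    Real.holderConjugate_iff.2 ⟨hρ, by simpa only [one_div] using hconj⟩
  obtain ⟨α, β, hmax⟩ := exists_dualObj_isMax x y h hμ0 hν0 hμ1 hν1 hdisj
  have hγ := isCoupling_dualCoupling_of_isMax x y h hμ0 hν0 hmax
  have heq := dualObj_eq_of_isCoupling_dualCoupling x y h hμ0 hν0 hdisj hγ
  have hnonneg : 0 ≤ dualObj x y μ ν s α β := by
    refine le_trans (le_of_eq ?_) (hmax 0 0)
    simp [dualObj, Real.zero_rpow h.symm.pos.ne']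
  have hleast : IsLeast {c | ∃ γ, IsCoupling μ ν γ ∧ c = transportCost x y μ ν ρ γ}
      (dualObj x y μ ν s α β ^ (1 / ρ)) := by
    refine ⟨⟨_, hγ, by rw [heq, transportCost]⟩, ?_⟩
    rintro _ ⟨γ, hγ', rfl⟩
    exact Real.rpow_le_rpow hnonneg
      (dualObj_le_of_isCoupling x y h hμ0 hν0 hdisj hγ' α β) (by have := h.pos; positivity)
  have hR : Rrho x y μ ν ρ ^ ρ = dualObj x y μ ν s α β := by
    rw [Rrho, hleast.csInf_eq, ← Real.rpow_mul hnonneg, one_div_mul_cancel h.pos.ne',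
      Real.rpow_one]
  rw [hR]
  refine ⟨⟨α, β, rfl⟩, ?_⟩
  rintro _ ⟨α', β', rfl⟩
  exact hmax α' β'
end
end

section
/- (Bounded penalty.) Let ρ > 1 with Hölder conjugate s ≥ 2, let μ, ν be distributions with positive weights on disjoint point sets {x_1,…,x_n}, {y_1,…,y_m} ⊂ ℝ^d. If (α, β) ∈ ℝ^{n+m} satisfies g(α, β) ≥ 0, then the penalty term satisfies C_s Σ_{i,j} μ_i ν_j ((α_i − β_j)^+ / ‖x_i − y_j‖₂)^s ≤ 4·R_ρ(μ, ν)^ρ. -/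
open Finset

noncomputable section

/-- The constant `C_s` is at least `4^{-(s-1)}` for `s ≥ 2`. -/
lemma one_quarter_rpow_le_Cs {s : ℝ} (hs : 2 ≤ s) : (1 / 4 : ℝ) ^ (s - 1) ≤ Cs s := by
  have hs0 : 0 < s := by linarith
  have hpow : s ≤ (2 : ℝ) ^ (s - 1) := by
    have := one_add_mul_self_le_rpow_one_add (s := 1) (by norm_num) (p := s - 1) (by linarith)
    norm_num at this
    exact this
  have hinv : (1 / 2 : ℝ) ^ (s - 1) ≤ 1 / s := by
    rw [Real.div_rpow (by norm_num) (by norm_num), Real.one_rpow]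
    exact one_div_le_one_div_of_le hs0 hpow
  have hbase : (1 / 2 : ℝ) ≤ 1 - 1 / s := by
    have := one_div_le_one_div_of_le (by norm_num) hs
    linarith
  have hsplit : (1 / 4 : ℝ) ^ (s - 1) = (1 / 2) ^ (s - 1) * (1 / 2) ^ (s - 1) := by
    rw [← Real.mul_rpow (by norm_num) (by norm_num)]
    norm_num
  rw [hsplit, Cs]
  exact mul_le_mul hinv (Real.rpow_le_rpow (by norm_num) hbase (by linarith)) (by positivity)
    (by positivity)

/-- Young's inequality with weights adapted to `C_s`. -/
lemma mul_le_Cs_mul_rpow_add {ρ s : ℝ} (hρ : 1 < ρ) (hs : 2 ≤ s) (hconj : 1 / ρ + 1 / s = 1)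
    {u t : ℝ} (hu : 0 ≤ u) (ht : 0 ≤ t) :
    t * u ≤ Cs s * t ^ s / s + 4 * u ^ ρ / ρ := by
  have hρ0 : 0 < ρ := by linarith
  have hs0 : 0 < s := by linarith
  have hpq : s.HolderConjugate ρ :=
    Real.holderConjugate_iff.mpr ⟨by linarith, by simpa [add_comm] using hconj⟩
  have hsρ : 1 / ρ * s = s - 1 := by
    field_simp at hconj ⊢
    linarith
  have hcancel : (1 / 4 : ℝ) ^ (1 / ρ) * 4 ^ (1 / ρ) = 1 := by
    rw [← Real.mul_rpow (by norm_num) (by norm_num)]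
    norm_num
  have hyoung := Real.young_inequality_of_nonneg
    (a := (1 / 4 : ℝ) ^ (1 / ρ) * t) (b := 4 ^ (1 / ρ) * u) (by positivity) (by positivity) hpq
  rw [Real.mul_rpow (by positivity) ht, Real.mul_rpow (by positivity) hu,
    ← Real.rpow_mul (by norm_num), ← Real.rpow_mul (by norm_num), hsρ,
    one_div_mul_cancel hρ0.ne', Real.rpow_one] at hyoung
  calc t * u = (1 / 4 : ℝ) ^ (1 / ρ) * t * (4 ^ (1 / ρ) * u) := by
        linear_combination (-t * u) * hcancel
    _ ≤ _ := hyoung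
    _ ≤ _ := by
        gcongr
        exact one_quarter_rpow_le_Cs hs

/-- The linear part of the dual objective, written as an integral against a coupling. -/
lemma IsCoupling.sum_sub_sum_eq {n m : ℕ} {μ : Fin n → ℝ} {ν : Fin m → ℝ}
    {γ : Fin n → Fin m → ℝ} (hγ : IsCoupling μ ν γ) (α : Fin n → ℝ) (β : Fin m → ℝ) :
    ∑ i, μ i * α i - ∑ j, ν j * β j = ∑ i, ∑ j, γ i j * (α i - β j) := by
  simp only [mul_sub, Finset.sum_sub_distrib]
  congr 1
  · exact Finset.sum_congr rfl fun i _ => by rw [← Finset.sum_mul, hγ.2.1]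
  · rw [Finset.sum_comm]
    exact Finset.sum_congr rfl fun j _ => by rw [← Finset.sum_mul, hγ.2.2]

/-- The product of two probability vectors is a coupling. -/
lemma isCoupling_mul {n m : ℕ} {μ : Fin n → ℝ} {ν : Fin m → ℝ} (hμ0 : ∀ i, 0 ≤ μ i)
    (hν0 : ∀ j, 0 ≤ ν j) (hμ1 : ∑ i, μ i = 1) (hν1 : ∑ j, ν j = 1) :
    IsCoupling μ ν fun i j => μ i * ν j :=
  ⟨fun i j => mul_nonneg (hμ0 i) (hν0 j), fun i => by rw [← Finset.mul_sum, hν1, mul_one],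
    fun j => by rw [← Finset.sum_mul, hμ1, one_mul]⟩

/-- If the dual objective is nonnegative, the penalty is at most four times the `ρ`-th power
cost of any coupling. -/
lemma penalty_le_of_isCoupling {d n m : ℕ} {x : Fin n → EuclideanSpace ℝ (Fin d)}
    {y : Fin m → EuclideanSpace ℝ (Fin d)} {ρ s : ℝ} (hρ : 1 < ρ) (hs : 2 ≤ s)
    (hconj : 1 / ρ + 1 / s = 1) {μ : Fin n → ℝ} {ν : Fin m → ℝ}
    (hμ0 : ∀ i, 0 < μ i) (hν0 : ∀ j, 0 < ν j) (hdisj : ∀ i j, x i ≠ y j)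
    {α : Fin n → ℝ} {β : Fin m → ℝ} (hg : 0 ≤ dualObj x y μ ν s α β)
    {γ : Fin n → Fin m → ℝ} (hγ : IsCoupling μ ν γ) :
    Cs s * ∑ i, ∑ j, μ i * ν j * (max (α i - β j) 0 / ‖x i - y j‖) ^ s ≤
      4 * ∑ i, ∑ j, μ i * ν j * ((γ i j / (μ i * ν j)) * ‖x i - y j‖) ^ ρ := by
  have hρ0 : 0 < ρ := by linarith
  rw [dualObj, hγ.sum_sub_sum_eq, sub_nonneg] at hg
  have hterm : ∀ i j, γ i j * (α i - β j) ≤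
      Cs s / s * (μ i * ν j * (max (α i - β j) 0 / ‖x i - y j‖) ^ s) +
        4 / ρ * (μ i * ν j * ((γ i j / (μ i * ν j)) * ‖x i - y j‖) ^ ρ) := by
    intro i j
    have hw : 0 < μ i * ν j := mul_pos (hμ0 i) (hν0 j)
    have hD : 0 < ‖x i - y j‖ := norm_pos_iff.mpr (sub_ne_zero.mpr (hdisj i j))
    have hγ0 := hγ.1 i j
    have hyoung := mul_le_Cs_mul_rpow_add hρ hs hconj
      (u := γ i j / (μ i * ν j) * ‖x i - y j‖) (t := max (α i - β j) 0 / ‖x i - y j‖)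
      (by positivity) (by positivity)
    calc γ i j * (α i - β j) ≤ γ i j * max (α i - β j) 0 := by
          gcongr
          exact le_max_left _ _
      _ = μ i * ν j * (max (α i - β j) 0 / ‖x i - y j‖ *
            (γ i j / (μ i * ν j) * ‖x i - y j‖)) := by
          generalize max (α i - β j) 0 = p
          have := hμ0 i
          have := hν0 j
          field_simp
      _ ≤ _ := mul_le_mul_of_nonneg_left hyoung hw.le
      _ = _ := by ring
  have hsum := hg.trans
    (Finset.sum_le_sum fun i _ => Finset.sum_le_sum fun j _ => hterm i j)
  simp only [Finset.sum_add_distrib, ← Finset.mul_sum] at hsum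
  refine le_of_mul_le_mul_left ?_ (one_div_pos.mpr hρ0)
  rw [eq_sub_of_add_eq hconj]
  have hρs : 1 / ρ = 1 - 1 / s := eq_sub_of_add_eq hconj
  rw [div_eq_mul_one_div (4 : ℝ) ρ, div_eq_mul_one_div (Cs s) s, hρs] at hsum
  linarith

/-- bounded penalty. If the dual objective is nonnegative at `(α, β)`, then the
penalty term is at most `4·R_ρ(μ,ν)^ρ`. -/
theorem bounded_penalty {d n m : ℕ} (x : Fin n → EuclideanSpace ℝ (Fin d))
    (y : Fin m → EuclideanSpace ℝ (Fin d)) (ρ s : ℝ) (hρ : 1 < ρ) (hs : 2 ≤ s)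
    (hconj : 1 / ρ + 1 / s = 1)
    (μ : Fin n → ℝ) (ν : Fin m → ℝ)
    (hμ0 : ∀ i, 0 < μ i) (hν0 : ∀ j, 0 < ν j)
    (hμ1 : ∑ i, μ i = 1) (hν1 : ∑ j, ν j = 1)
    (hdisj : ∀ i j, x i ≠ y j)
    (α : Fin n → ℝ) (β : Fin m → ℝ)
    (hg : 0 ≤ dualObj x y μ ν s α β) :
    Cs s * ∑ i, ∑ j, μ i * ν j * (max (α i - β j) 0 / ‖x i - y j‖) ^ s ≤
      4 * Rrho x y μ ν ρ ^ ρ := by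
  have hρ0 : 0 < ρ := by linarith
  have hP : 0 ≤ Cs s * ∑ i, ∑ j, μ i * ν j * (max (α i - β j) 0 / ‖x i - y j‖) ^ s := by
    have hC : 0 ≤ Cs s := le_trans (by positivity) (one_quarter_rpow_le_Cs hs)
    refine mul_nonneg hC (Finset.sum_nonneg fun i _ => Finset.sum_nonneg fun j _ => ?_)
    have := hμ0 i
    have := hν0 j
    positivity
  have hbound := fun γ (hγ : IsCoupling μ ν γ) =>
    penalty_le_of_isCoupling hρ hs hconj hμ0 hν0 hdisj hg hγ
  generalize Cs s * ∑ i, ∑ j, μ i * ν j * (max (α i - β j) 0 / ‖x i - y j‖) ^ s = P at hP hbound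
  have hR : (P / 4) ^ (1 / ρ) ≤ Rrho x y μ ν ρ := by
    refine le_csInf
      ⟨_, _, isCoupling_mul (fun i => (hμ0 i).le) (fun j => (hν0 j).le) hμ1 hν1, rfl⟩ ?_
    rintro c ⟨γ, hγ, rfl⟩
    have := hbound γ hγ
    exact Real.rpow_le_rpow (by positivity) (by linarith) (by positivity)
  have hpow := Real.rpow_le_rpow (by positivity) hR hρ0.le
  rw [← Real.rpow_mul (by positivity), one_div_mul_cancel hρ0.ne', Real.rpow_one] at hpow
  linarith
end
end

section
/- (Bounded penalty gradient, first bound.) Let ρ ∈ (1, 2) with Hölder conjugate s > 2, let μ, ν be distributions with positive weights on disjoint point sets {x_1,…,x_n}, {y_1,…,y_m} ⊂ ℝ^d, and suppose r_min ≤ ‖x_i − y_j‖₂ ≤ r for all i, j, where 0 < r_min ≤ r. If (α, β) ∈ ℝ^{n+m} satisfies g(α, β) ≥ 0, then C_s Σ_{i,j} μ_i ν_j ((α_i − β_j)^+)^{s−1} / ‖x_i − y_j‖₂^s ≤ 4r / r_min. -/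
open Finset

noncomputable section

theorem Cs_nonneg {s : ℝ} (hs : 1 ≤ s) : 0 ≤ Cs s := by
  have h : 1 / s ≤ 1 := (div_le_one (by linarith)).2 hs
  have h0 : 0 ≤ 1 - 1 / s := by linarith
  unfold Cs
  positivity

/-- Chebyshev's correlation inequality for a nonnegative random variable and its power. -/
theorem sum_mul_sum_rpow_le_sum_rpow {ι : Type*} [Fintype ι] (w u : ι → ℝ)
    (hw : ∀ k, 0 ≤ w k) (hw1 : ∑ k, w k = 1) (hu : ∀ k, 0 ≤ u k) {q : ℝ} (hq : 0 ≤ q) :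
    (∑ k, w k * u k) * ∑ k, w k * u k ^ q ≤ ∑ k, w k * u k ^ (q + 1) := by
  set A := ∑ k, w k * u k with hA
  have hA0 : 0 ≤ A := sum_nonneg fun k _ => mul_nonneg (hw k) (hu k)
  have key (k : ι) : A * u k ^ q + A ^ q * (u k - A) ≤ u k ^ (q + 1) := by
    rw [Real.rpow_add_one' (hu k) (by linarith)]
    rcases le_total A (u k) with h | h
    · nlinarith [Real.rpow_le_rpow hA0 h hq]
    · nlinarith [Real.rpow_le_rpow (hu k) h hq]
  have hsum := sum_le_sum fun k (_ : k ∈ univ) => mul_le_mul_of_nonneg_left (key k) (hw k)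
  have hexp : ∑ k, w k * (A * u k ^ q + A ^ q * (u k - A)) =
      A * ∑ k, w k * u k ^ q + A ^ q * (∑ k, w k * u k - A * ∑ k, w k) := by
    rw [mul_sum univ w A, ← sum_sub_distrib, mul_sum, mul_sum, ← sum_add_distrib]
    exact sum_congr rfl fun k _ => by ring
  rw [hexp, hw1, ← hA] at hsum
  linarith

/-- If `C · E[u ^ (q + 1)] ≤ r · E[u]` then `C · E[u ^ q] ≤ r`. -/
theorem mul_sum_rpow_le_of_mul_sum_rpow_add_one_le {ι : Type*} [Fintype ι] (w u : ι → ℝ)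
    (hw : ∀ k, 0 < w k) (hw1 : ∑ k, w k = 1) (hu : ∀ k, 0 ≤ u k) {q C r : ℝ} (hq : 0 < q)
    (hC : 0 ≤ C) (hr : 0 ≤ r)
    (h : C * ∑ k, w k * u k ^ (q + 1) ≤ r * ∑ k, w k * u k) :
    C * ∑ k, w k * u k ^ q ≤ r := by
  have hcheb := sum_mul_sum_rpow_le_sum_rpow w u (fun k => (hw k).le) hw1 hu hq.le
  have hnn (k : ι) : 0 ≤ w k * u k := mul_nonneg (hw k).le (hu k)
  rcases (sum_nonneg fun k (_ : k ∈ univ) => hnn k).eq_or_lt with h0 | hpos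
  · have hz := (sum_eq_zero_iff_of_nonneg fun k _ => hnn k).1 h0.symm
    have hz' (k : ι) : u k = 0 := (mul_eq_zero.1 (hz k (mem_univ k))).resolve_left (hw k).ne'
    simpa [hz', Real.zero_rpow hq.ne'] using hr
  · refine le_of_mul_le_mul_right ?_ hpos
    nlinarith [mul_le_mul_of_nonneg_left hcheb hC]

/-- A separable linear functional is the mean of the differences under the product weights. -/
theorem sum_mul_sub_sum_mul_eq_sum_sum {n m : ℕ} (μ α : Fin n → ℝ) (ν β : Fin m → ℝ)
    (hμ1 : ∑ i, μ i = 1) (hν1 : ∑ j, ν j = 1) :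
    ∑ i, μ i * α i - ∑ j, ν j * β j = ∑ i, ∑ j, μ i * ν j * (α i - β j) := by
  have h1 : ∑ i, ∑ j, μ i * ν j * α i = ∑ i, μ i * α i := by
    refine sum_congr rfl fun i _ => ?_
    rw [← sum_mul, ← mul_sum, hν1, mul_one]
  have h2 : ∑ i, ∑ j, μ i * ν j * β j = ∑ j, ν j * β j := by
    rw [sum_comm]
    refine sum_congr rfl fun j _ => ?_
    rw [← sum_mul, ← sum_mul, hμ1, one_mul]
  simp only [mul_sub, sum_sub_distrib, h1, h2]

/-- bounded penalty gradient, first bound. -/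
theorem bounded_penalty_grad_one {d n m : ℕ} (x : Fin n → EuclideanSpace ℝ (Fin d))
    (y : Fin m → EuclideanSpace ℝ (Fin d)) (ρ s : ℝ) (hρ1 : 1 < ρ) (hρ2 : ρ < 2) (hs : 2 < s)
    (hconj : 1 / ρ + 1 / s = 1)
    (μ : Fin n → ℝ) (ν : Fin m → ℝ)
    (hμ0 : ∀ i, 0 < μ i) (hν0 : ∀ j, 0 < ν j)
    (hμ1 : ∑ i, μ i = 1) (hν1 : ∑ j, ν j = 1)
    (hdisj : ∀ i j, x i ≠ y j)
    (rmin r : ℝ) (hrmin : 0 < rmin) (hrr : rmin ≤ r)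
    (hlo : ∀ i j, rmin ≤ ‖x i - y j‖) (hhi : ∀ i j, ‖x i - y j‖ ≤ r)
    (α : Fin n → ℝ) (β : Fin m → ℝ)
    (hg : 0 ≤ dualObj x y μ ν s α β) :
    Cs s * ∑ i, ∑ j, μ i * ν j * (max (α i - β j) 0 ^ (s - 1) / ‖x i - y j‖ ^ s) ≤
      4 * r / rmin := by
  have hr : 0 < r := hrmin.trans_le hrr
  have hD (i j) : 0 < ‖x i - y j‖ := hrmin.trans_le (hlo i j)
  have hp (i j) : 0 < μ i * ν j := mul_pos (hμ0 i) (hν0 j)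
  have hC : 0 ≤ Cs s := Cs_nonneg (by linarith)
  let w : Fin n × Fin m → ℝ := fun k => μ k.1 * ν k.2
  let u : Fin n × Fin m → ℝ := fun k => max (α k.1 - β k.2) 0 / ‖x k.1 - y k.2‖
  have hu (k) : 0 ≤ u k := div_nonneg (le_max_right _ _) (norm_nonneg _)
  have hw1 : ∑ k, w k = 1 := by
    simp only [w, Fintype.sum_prod_type, ← mul_sum, hν1, mul_one, hμ1]
  have hlin : ∑ i, μ i * α i - ∑ j, ν j * β j ≤ r * ∑ k, w k * u k := by
    rw [sum_mul_sub_sum_mul_eq_sum_sum μ α ν β hμ1 hν1, Fintype.sum_prod_type]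
    simp only [mul_sum]
    refine sum_le_sum fun i _ => sum_le_sum fun j _ => ?_
    have h1 : α i - β j ≤ r * u (i, j) :=
      calc α i - β j ≤ max (α i - β j) 0 := le_max_left _ _
        _ = ‖x i - y j‖ * u (i, j) := (mul_div_cancel₀ _ (hD i j).ne').symm
        _ ≤ r * u (i, j) := mul_le_mul_of_nonneg_right (hhi i j) (hu _)
    calc μ i * ν j * (α i - β j) ≤ μ i * ν j * (r * u (i, j)) :=
          mul_le_mul_of_nonneg_left h1 (hp i j).le
      _ = r * (w (i, j) * u (i, j)) := by ring
  have hpen : Cs s * ∑ k, w k * u k ^ (s - 1 + 1) ≤ r * ∑ k, w k * u k := by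
    have hg' : Cs s * ∑ k, w k * u k ^ s ≤ ∑ i, μ i * α i - ∑ j, ν j * β j := by
      rw [Fintype.sum_prod_type]
      exact sub_nonneg.1 hg
    rw [sub_add_cancel]
    exact hg'.trans hlin
  have hmain := mul_sum_rpow_le_of_mul_sum_rpow_add_one_le w u (fun k => hp k.1 k.2) hw1 hu
    (by linarith) hC hr.le hpen
  have hterm : ∑ i, ∑ j, μ i * ν j * (max (α i - β j) 0 ^ (s - 1) / ‖x i - y j‖ ^ s) ≤
      (∑ k, w k * u k ^ (s - 1)) / rmin := by
    rw [Fintype.sum_prod_type]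
    simp only [sum_div]
    refine sum_le_sum fun i _ => sum_le_sum fun j _ => ?_
    rw [mul_div_assoc]
    refine mul_le_mul_of_nonneg_left ?_ (hp i j).le
    have hs1 : ‖x i - y j‖ ^ s = ‖x i - y j‖ ^ (s - 1) * ‖x i - y j‖ := by
      rw [← Real.rpow_add_one (hD i j).ne', sub_add_cancel]
    rw [hs1, ← div_div, ← Real.div_rpow (le_max_right _ _) (norm_nonneg _)]
    exact div_le_div_of_nonneg_left (Real.rpow_nonneg (hu (i, j)) _) hrmin (hlo i j)
  calc _ ≤ Cs s * ((∑ k, w k * u k ^ (s - 1)) / rmin) := mul_le_mul_of_nonneg_left hterm hC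
    _ = Cs s * (∑ k, w k * u k ^ (s - 1)) / rmin := (mul_div_assoc _ _ _).symm
    _ ≤ 4 * r / rmin := div_le_div_of_nonneg_right (by linarith) hrmin.le
end
end

section
/- (Preprocessing perturbation of μ.) Let ρ ≥ 1, r > 0, 0 < σ ≤ 1, σ_μ > 0. Let μ be a distribution with weights μ_1,…,μ_n on points x_1,…,x_n ∈ ℝ^d, set L_μ = {i : μ_i < σ_μ/n} and ζ_μ = Σ_{i∈L_μ} μ_i, and assume ζ_μ < 1. Embed each x_i into ℝ^{d+1} as (x_i, 0) and define lifted points x′_i = (x_i, σr). Let μ′ be the distribution on the points x′_1,…,x′_n with weights μ′_i = 0 for i ∈ L_μ and μ′_i = μ_i/(1 − ζ_μ) otherwise. Then R_ρ(μ, μ′)^ρ ≤ (n^{ρ−1}·σ^ρ/σ_μ^{ρ−1})·r^ρ + ζ_μ·(r·√(1+σ²))^ρ; in particular, since ζ_μ ≤ σ_μ, R_ρ(μ, μ′) ≤ (n^{ρ−1}·σ^ρ/σ_μ^{ρ−1} + σ_μ·(1+σ²)^{ρ/2})^{1/ρ} · r. -/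
open Finset

noncomputable section

/-- Embed a point of `ℝ^d` into `ℝ^{d+1}`, appending the last coordinate `c`. -/
def liftPt {d : ℕ} (c : ℝ) (v : EuclideanSpace ℝ (Fin d)) : EuclideanSpace ℝ (Fin (d + 1)) :=
  (WithLp.equiv 2 (Fin (d + 1) → ℝ)).symm (Fin.snoc ((WithLp.equiv 2 (Fin d → ℝ)) v) c)

/-- `ζ_μ`: the total mass of indices whose weight is below the threshold `θ`. -/
def lowMass {n : ℕ} (μ : Fin n → ℝ) (θ : ℝ) : ℝ :=
  ∑ i ∈ Finset.univ.filter (fun i => μ i < θ), μ i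

/-- `μ′`: weights with low-probability indices removed, renormalized. -/
def truncWeights {n : ℕ} (μ : Fin n → ℝ) (θ : ℝ) : Fin n → ℝ :=
  fun i => if μ i < θ then 0 else μ i / (1 - lowMass μ θ)

theorem norm_liftPt_sub_sq {d : ℕ} (a b : ℝ) (v w : EuclideanSpace ℝ (Fin d)) :
    ‖liftPt a v - liftPt b w‖ ^ 2 = ‖v - w‖ ^ 2 + (a - b) ^ 2 := by
  rw [EuclideanSpace.norm_sq_eq, EuclideanSpace.norm_sq_eq, Fin.sum_univ_castSucc]
  simp [liftPt]

theorem transportCost_nonneg {d n m : ℕ} {x : Fin n → EuclideanSpace ℝ (Fin d)}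
    {y : Fin m → EuclideanSpace ℝ (Fin d)} {μ : Fin n → ℝ} {ν : Fin m → ℝ} {ρ : ℝ}
    {γ : Fin n → Fin m → ℝ} (hμ : ∀ i, 0 ≤ μ i) (hν : ∀ j, 0 ≤ ν j) (hγ : ∀ i j, 0 ≤ γ i j) :
    0 ≤ transportCost x y μ ν ρ γ := by
  refine Real.rpow_nonneg (sum_nonneg fun i _ => sum_nonneg fun j _ => ?_) _
  have hij := mul_nonneg (hμ i) (hν j)
  exact mul_nonneg hij
    (Real.rpow_nonneg (mul_nonneg (div_nonneg (hγ i j) hij) (norm_nonneg _)) _)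

theorem Rrho_nonneg {d n m : ℕ} {x : Fin n → EuclideanSpace ℝ (Fin d)}
    {y : Fin m → EuclideanSpace ℝ (Fin d)} {μ : Fin n → ℝ} {ν : Fin m → ℝ} {ρ : ℝ}
    (hμ : ∀ i, 0 ≤ μ i) (hν : ∀ j, 0 ≤ ν j) : 0 ≤ Rrho x y μ ν ρ := by
  refine Real.sInf_nonneg ?_
  rintro c ⟨γ, hγ, rfl⟩
  exact transportCost_nonneg hμ hν hγ.1

theorem Rrho_le_transportCost {d n m : ℕ} {x : Fin n → EuclideanSpace ℝ (Fin d)}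
    {y : Fin m → EuclideanSpace ℝ (Fin d)} {μ : Fin n → ℝ} {ν : Fin m → ℝ} {ρ : ℝ}
    {γ : Fin n → Fin m → ℝ} (hμ : ∀ i, 0 ≤ μ i) (hν : ∀ j, 0 ≤ ν j) (hγ : IsCoupling μ ν γ) :
    Rrho x y μ ν ρ ≤ transportCost x y μ ν ρ γ := by
  refine csInf_le ⟨0, ?_⟩ ⟨γ, hγ, rfl⟩
  rintro c ⟨γ', hγ', rfl⟩
  exact transportCost_nonneg hμ hν hγ'.1

theorem Rrho_rpow_le {d n m : ℕ} {x : Fin n → EuclideanSpace ℝ (Fin d)}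
    {y : Fin m → EuclideanSpace ℝ (Fin d)} {μ : Fin n → ℝ} {ν : Fin m → ℝ} {ρ : ℝ}
    {γ : Fin n → Fin m → ℝ} (hρ : 0 < ρ) (hμ : ∀ i, 0 ≤ μ i) (hν : ∀ j, 0 ≤ ν j)
    (hγ : IsCoupling μ ν γ) :
    Rrho x y μ ν ρ ^ ρ ≤
      ∑ i, ∑ j, μ i * ν j * ((γ i j / (μ i * ν j)) * ‖x i - y j‖) ^ ρ := by
  refine (Real.rpow_le_rpow (Rrho_nonneg hμ hν) (Rrho_le_transportCost hμ hν hγ) hρ.le).trans ?_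
  rw [transportCost, one_div, Real.rpow_inv_rpow _ hρ.ne']
  refine sum_nonneg fun i _ => sum_nonneg fun j _ => ?_
  have hij := mul_nonneg (hμ i) (hν j)
  exact mul_nonneg hij
    (Real.rpow_nonneg (mul_nonneg (div_nonneg (hγ.1 i j) hij) (norm_nonneg _)) _)

section Truncation

variable {n : ℕ} {μ : Fin n → ℝ} {θ : ℝ}

theorem lowMass_nonneg (hμ : ∀ i, 0 ≤ μ i) : 0 ≤ lowMass μ θ :=
  sum_nonneg fun i _ => hμ i

theorem lowMass_le (hθ : 0 ≤ θ) : lowMass μ θ ≤ n * θ := by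
  calc lowMass μ θ ≤ ∑ i ∈ univ.filter (fun i => μ i < θ), θ :=
        sum_le_sum fun i hi => (mem_filter.1 hi).2.le
    _ ≤ ∑ _i : Fin n, θ := sum_le_sum_of_subset_of_nonneg (filter_subset _ _) fun _ _ _ => hθ
    _ = n * θ := by simp

theorem lowMass_add_sum_not_lt (hμ1 : ∑ i, μ i = 1) :
    lowMass μ θ + ∑ i ∈ univ.filter (fun i => ¬ μ i < θ), μ i = 1 := by
  rw [lowMass, sum_filter_add_sum_filter_not, hμ1]

theorem truncWeights_nonneg (hμ : ∀ i, 0 ≤ μ i) (hζ : lowMass μ θ < 1) (i : Fin n) :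
    0 ≤ truncWeights μ θ i := by
  unfold truncWeights
  split_ifs
  · exact le_rfl
  · exact div_nonneg (hμ i) (sub_pos.2 hζ).le

theorem le_truncWeights (hμ : ∀ i, 0 ≤ μ i) (hζ : lowMass μ θ < 1) {i : Fin n}
    (hi : ¬ μ i < θ) : μ i ≤ truncWeights μ θ i := by
  rw [truncWeights, if_neg hi]
  exact le_div_self (hμ i) (sub_pos.2 hζ) (sub_le_self _ (lowMass_nonneg hμ))

theorem sum_truncWeights (hμ1 : ∑ i, μ i = 1) (hζ : lowMass μ θ < 1) :
    ∑ i, truncWeights μ θ i = 1 := by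
  have h := lowMass_add_sum_not_lt (θ := θ) hμ1
  have h' : 1 - lowMass μ θ ≠ 0 := (sub_pos.2 hζ).ne'
  simp only [truncWeights]
  rw [← sum_filter_add_sum_filter_not univ (fun i => μ i < θ),
    sum_congr rfl (fun i hi => if_pos (mem_filter.1 hi).2),
    sum_congr rfl (fun i hi => if_neg (mem_filter.1 hi).2), sum_const_zero, zero_add,
    ← sum_div, div_eq_one_iff_eq h']
  linarith

/-- Heavy points keep their mass in place; the mass of each light point is spread
proportionally to the truncated weights. -/
def truncCoupling (μ : Fin n → ℝ) (θ : ℝ) (i j : Fin n) : ℝ :=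
  if μ i < θ then μ i * truncWeights μ θ j else if i = j then μ i else 0

theorem isCoupling_truncCoupling (hμ : ∀ i, 0 ≤ μ i) (hμ1 : ∑ i, μ i = 1)
    (hζ : lowMass μ θ < 1) : IsCoupling μ (truncWeights μ θ) (truncCoupling μ θ) := by
  refine ⟨fun i j => ?_, fun i => ?_, fun j => ?_⟩
  · unfold truncCoupling
    split_ifs
    exacts [mul_nonneg (hμ i) (truncWeights_nonneg hμ hζ j), hμ i, le_rfl]
  · unfold truncCoupling
    split_ifs
    · rw [← mul_sum, sum_truncWeights hμ1 hζ, mul_one]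
    · simp
  · have h' : 1 - lowMass μ θ ≠ 0 := (sub_pos.2 hζ).ne'
    simp only [truncCoupling]
    rw [← sum_filter_add_sum_filter_not univ (fun i => μ i < θ),
      sum_congr rfl (fun i hi => if_pos (mem_filter.1 hi).2),
      sum_congr rfl (fun i hi => if_neg (mem_filter.1 hi).2), ← sum_mul, sum_ite_eq']
    change lowMass μ θ * truncWeights μ θ j + _ = _
    by_cases hj : μ j < θ
    · simp [truncWeights, hj]
    · simp only [truncWeights, hj, mem_filter, mem_univ, true_and, if_false, not_false_eq_true,
        if_true]
      field_simp
      ring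

end Truncation

theorem mul_mul_div_mul_rpow_le {a b θ c ρ : ℝ} (hρ : 1 ≤ ρ) (hθ : 0 < θ) (ha : 0 < a)
    (hb : θ ≤ b) (hc : 0 ≤ c) :
    a * b * (a / (a * b) * c) ^ ρ ≤ a * (c ^ ρ / θ ^ (ρ - 1)) := by
  have hb0 : 0 < b := hθ.trans_le hb
  have hab : a / (a * b) * c = c / b := by field_simp
  have hbρ : b ^ ρ = b ^ (ρ - 1) * b := by
    rw [← Real.rpow_add_one hb0.ne', sub_add_cancel]
  have hpos : 0 < b ^ (ρ - 1) := Real.rpow_pos_of_pos hb0 _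
  calc a * b * (a / (a * b) * c) ^ ρ = a * (c ^ ρ / b ^ (ρ - 1)) := by
        rw [hab, Real.div_rpow hc hb0.le, hbρ]
        field_simp
    _ ≤ a * (c ^ ρ / θ ^ (ρ - 1)) := by
        have hle : θ ^ (ρ - 1) ≤ b ^ (ρ - 1) :=
          Real.rpow_le_rpow hθ.le hb (sub_nonneg.2 hρ)
        have hθpos : 0 < θ ^ (ρ - 1) := Real.rpow_pos_of_pos hθ _
        have hcρ : 0 ≤ c ^ ρ := Real.rpow_nonneg hc _
        gcongr

/-- If mass moved within an index costs distance at most `s` and any other mass distance at most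
`D`, truncating the weights below `θ` is a small perturbation in `R_ρ`. -/
theorem Rrho_truncWeights_rpow_le {d n : ℕ} {x y : Fin n → EuclideanSpace ℝ (Fin d)}
    {μ : Fin n → ℝ} {ρ θ s D : ℝ} (hρ : 1 ≤ ρ) (hθ : 0 < θ)
    (hμ : ∀ i, 0 ≤ μ i) (hμ1 : ∑ i, μ i = 1) (hζ : lowMass μ θ < 1)
    (hs : ∀ i, ‖x i - y i‖ ≤ s) (hs0 : 0 ≤ s) (hD : ∀ i j, ‖x i - y j‖ ≤ D) :
    Rrho x y μ (truncWeights μ θ) ρ ^ ρ ≤ s ^ ρ / θ ^ (ρ - 1) + lowMass μ θ * D ^ ρ := by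
  have hρ0 : 0 < ρ := one_pos.trans_le hρ
  have hν := truncWeights_nonneg hμ hζ
  have hA : 0 ≤ s ^ ρ / θ ^ (ρ - 1) :=
    div_nonneg (Real.rpow_nonneg hs0 _) (Real.rpow_nonneg hθ.le _)
  refine (Rrho_rpow_le hρ0 hμ hν (isCoupling_truncCoupling hμ hμ1 hζ)).trans ?_
  rw [← sum_filter_add_sum_filter_not univ (fun i => μ i < θ), add_comm]
  refine add_le_add ?_ ?_
  · calc _ ≤ ∑ i ∈ univ.filter (fun i => ¬ μ i < θ), μ i * (s ^ ρ / θ ^ (ρ - 1)) := by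
          refine sum_le_sum fun i hi => ?_
          have hi' : ¬ μ i < θ := (mem_filter.1 hi).2
          have hpos : 0 < μ i := hθ.trans_le (not_lt.1 hi')
          have hνi : θ ≤ truncWeights μ θ i := (not_lt.1 hi').trans (le_truncWeights hμ hζ hi')
          rw [sum_eq_single i]
          · simp only [truncCoupling, hi', if_false, if_true]
            refine (mul_mul_div_mul_rpow_le hρ hθ hpos hνi (norm_nonneg _)).trans ?_
            have := hs i
            gcongr
          · intro j _ hj
            simp [truncCoupling, hi', hj.symm, Real.zero_rpow hρ0.ne']
          · simp
      _ ≤ 1 * (s ^ ρ / θ ^ (ρ - 1)) := by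
          rw [← sum_mul]
          refine mul_le_mul_of_nonneg_right ?_ hA
          linarith [lowMass_add_sum_not_lt (θ := θ) hμ1, lowMass_nonneg (θ := θ) hμ]
      _ = _ := one_mul _
  · rw [lowMass, sum_mul]
    refine sum_le_sum fun i hi => ?_
    have hi' : μ i < θ := (mem_filter.1 hi).2
    calc _ ≤ ∑ j, μ i * truncWeights μ θ j * D ^ ρ := by
          refine sum_le_sum fun j _ => ?_
          have hij := mul_nonneg (hμ i) (hν j)
          simp only [truncCoupling, hi', if_true]
          refine mul_le_mul_of_nonneg_left (Real.rpow_le_rpow ?_ ?_ hρ0.le) hij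
          · positivity
          · calc _ ≤ 1 * ‖x i - y j‖ :=
                  mul_le_mul_of_nonneg_right (div_self_le_one _) (norm_nonneg _)
              _ ≤ D := (one_mul _).trans_le (hD i j)
      _ = μ i * D ^ ρ := by rw [← sum_mul, ← mul_sum, sum_truncWeights hμ1 hζ, mul_one]

/-- preprocessing perturbation of `μ`. Here `μ` lives on the lifted points
`(x_i, 0)` and `μ′` on `(x_i, σr)` in `ℝ^{d+1}`. -/
theorem preprocess_mu {d n : ℕ} (x : Fin n → EuclideanSpace ℝ (Fin d))
    (ρ r σ σμ : ℝ) (hρ : 1 ≤ ρ) (hr : 0 < r) (hσ0 : 0 < σ) (hσ1 : σ ≤ 1) (hσμ : 0 < σμ)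
    (μ : Fin n → ℝ) (hμ0 : ∀ i, 0 ≤ μ i) (hμ1 : ∑ i, μ i = 1)
    (hxr : ∀ i j, ‖x i - x j‖ ≤ r)
    (hζ : lowMass μ (σμ / n) < 1) :
    Rrho (fun i => liftPt 0 (x i)) (fun i => liftPt (σ * r) (x i))
        μ (truncWeights μ (σμ / n)) ρ ^ ρ ≤
      (n : ℝ) ^ (ρ - 1) * σ ^ ρ / σμ ^ (ρ - 1) * r ^ ρ +
        lowMass μ (σμ / n) * (r * Real.sqrt (1 + σ ^ 2)) ^ ρ ∧
    Rrho (fun i => liftPt 0 (x i)) (fun i => liftPt (σ * r) (x i))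
        μ (truncWeights μ (σμ / n)) ρ ≤
      ((n : ℝ) ^ (ρ - 1) * σ ^ ρ / σμ ^ (ρ - 1) + σμ * (1 + σ ^ 2) ^ (ρ / 2)) ^ (1 / ρ) * r := by
  have hρ0 : 0 < ρ := one_pos.trans_le hρ
  have hn : 0 < (n : ℝ) := by
    rcases n.eq_zero_or_pos with rfl | h
    · simp at hμ1
    · exact_mod_cast h
  have hθ : 0 < σμ / n := div_pos hσμ hn
  have hσr : 0 ≤ σ * r := (mul_pos hσ0 hr).le
  have hfirst : Rrho (fun i => liftPt 0 (x i)) (fun i => liftPt (σ * r) (x i))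
        μ (truncWeights μ (σμ / n)) ρ ^ ρ ≤
      (n : ℝ) ^ (ρ - 1) * σ ^ ρ / σμ ^ (ρ - 1) * r ^ ρ +
        lowMass μ (σμ / n) * (r * Real.sqrt (1 + σ ^ 2)) ^ ρ := by
    refine (Rrho_truncWeights_rpow_le (s := σ * r) (D := r * Real.sqrt (1 + σ ^ 2)) hρ hθ hμ0 hμ1
      hζ (fun i => ?_) hσr (fun i j => ?_)).trans_eq ?_
    · refine (sq_le_sq₀ (norm_nonneg _) hσr).1 ?_
      rw [norm_liftPt_sub_sq]
      simp
    · refine (sq_le_sq₀ (norm_nonneg _) (by positivity)).1 ?_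
      rw [norm_liftPt_sub_sq, mul_pow, Real.sq_sqrt (by positivity)]
      have := pow_le_pow_left₀ (norm_nonneg _) (hxr i j) 2
      linarith
    · congr 1
      rw [Real.mul_rpow hσ0.le hr.le, Real.div_rpow hσμ.le hn.le]
      have := (Real.rpow_pos_of_pos hσμ (ρ - 1)).ne'
      have := (Real.rpow_pos_of_pos hn (ρ - 1)).ne'
      field_simp
  refine ⟨hfirst, ?_⟩
  have hζσ : lowMass μ (σμ / n) ≤ σμ :=
    (lowMass_le hθ.le).trans_eq (mul_div_cancel₀ _ hn.ne')
  have hsqrt : Real.sqrt (1 + σ ^ 2) ^ ρ = (1 + σ ^ 2) ^ (ρ / 2) := by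
    rw [Real.sqrt_eq_rpow, ← Real.rpow_mul (by positivity)]
    congr 1
    ring
  rw [← Real.rpow_le_rpow_iff (Rrho_nonneg hμ0 (truncWeights_nonneg hμ0 hζ)) (by positivity) hρ0,
    Real.mul_rpow (by positivity) hr.le, one_div, Real.rpow_inv_rpow (by positivity) hρ0.ne']
  refine hfirst.trans ?_
  rw [add_mul, Real.mul_rpow hr.le (Real.sqrt_nonneg _), hsqrt, mul_assoc σμ,
    mul_comm (r ^ ρ) ((1 + σ ^ 2) ^ (ρ / 2))]
  gcongr
end
end
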